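/- For every nondegenerate triangle K in ℝ², the space Σʳ(K) := {τ ∈ ℙ₃(K;𝕊) : div τ ∈ RM and the restriction of t_iᵀ τ n_i to e_i is a polynomial of degree at most 2 for each edge e_i} equals the internal direct sum airy(ℙ₅⁻(K)) ⊕ {x ↦ sym(v(x) xᵀ) : v ∈ RM}, and dim Σʳ(K) = 18. -/

import Mathlib

open MeasureTheory Matrix

noncomputable section

/-- Points of the plane ℝ². -/
abbrev V2 := Fin 2 → ℝ

/-- 2×2 real matrices. -/
abbrev Mat2 := Matrix (Fin 2) (Fin 2) ℝ

/-- The Euclidean dot product on ℝ². -/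
def dot2 (x y : V2) : ℝ := x 0 * y 0 + x 1 * y 1

/-- The Euclidean norm on ℝ². -/
def norm2 (x : V2) : ℝ := Real.sqrt (dot2 x x)

/-- Rotation by -90 degrees, used to produce a unit normal from a unit tangent. -/
def rot (x : V2) : V2 := ![x 1, -(x 0)]

/-- The closed triangle with vertices `v 0, v 1, v 2`. -/
def tri (v : Fin 3 → V2) : Set V2 := convexHull ℝ (Set.range v)

/-- `f` is (the function of) a real polynomial in two variables of total degree at most `k`. -/
def PolyDeg (k : ℕ) (f : V2 → ℝ) : Prop :=
  ∃ p : MvPolynomial (Fin 2) ℝ, p.totalDegree ≤ k ∧ ∀ x : V2, f x = MvPolynomial.eval x p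

/-- matrix-valued polynomial fields of degree at most `k`, i.e. ℙ_k(·;𝕄). -/
def IsPolyMat (k : ℕ) (τ : V2 → Mat2) : Prop := ∀ i j, PolyDeg k fun x => τ x i j

/-- vector-valued polynomial fields of degree at most `k`, i.e. ℙ_k(·;ℝ²). -/
def IsPolyVec (k : ℕ) (f : V2 → V2) : Prop := ∀ i, PolyDeg k fun x => f x i

/-- `f` agrees on `[0,1]` with a univariate polynomial of degree at most `k`
(used for restrictions to an edge, in an affine parametrization of the edge). -/
def IsPoly1 (k : ℕ) (f : ℝ → ℝ) : Prop :=
  ∃ p : Polynomial ℝ, p.natDegree ≤ k ∧ ∀ s ∈ Set.Icc (0:ℝ) 1, f s = Polynomial.eval s p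

/-- Partial derivative in the `a`-th coordinate direction. -/
def pd (f : V2 → ℝ) (a : Fin 2) : V2 → ℝ := fun x => fderiv ℝ f x (Pi.single a 1)

/-- Directional derivative of `f` in direction `w`. -/
def dirD (f : V2 → ℝ) (w : V2) (x : V2) : ℝ := fderiv ℝ f x w

/-- Row-wise divergence of a matrix-valued field. -/
def divMat (τ : V2 → Mat2) : V2 → V2 := fun x i => ∑ j, pd (fun y => τ y i j) j x

/-- The edge `e i` of the triangle, opposite to the vertex `v i`. -/
def edgeSet (v : Fin 3 → V2) (i : Fin 3) : Set V2 := segment ℝ (v (i+1)) (v (i+2))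

/-- Affine parametrization of the edge `e i` over `[0,1]`. -/
def edgePt (v : Fin 3 → V2) (i : Fin 3) (s : ℝ) : V2 := v (i+1) + s • (v (i+2) - v (i+1))

/-- The length of the edge `e i`. -/
def elen (v : Fin 3 → V2) (i : Fin 3) : ℝ := norm2 (v (i+2) - v (i+1))

/-- The unit tangent vector of the edge `e i`. -/
def tang (v : Fin 3 → V2) (i : Fin 3) : V2 := (elen v i)⁻¹ • (v (i+2) - v (i+1))

/-- The unit normal vector of the edge `e i`. -/
def nrml (v : Fin 3 → V2) (i : Fin 3) : V2 := rot (tang v i)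

/-- The arclength integral over the edge `e i`. -/
def edgeInt (v : Fin 3 → V2) (i : Fin 3) (f : V2 → ℝ) : ℝ :=
  ∫ s in (0:ℝ)..1, f (edgePt v i s) * elen v i

/-- The symmetric part of a matrix. -/
def symm2 (A : Mat2) : Mat2 := (2:ℝ)⁻¹ • (A + Aᵀ)

/-- The shape function space Σ(K) = {τ ∈ ℙ₃(K;𝕊) : div τ ∈ ℙ₁(K;ℝ²),
tᵀτn|ₑ ∈ ℙ₂(e) for each edge e}. -/
def SigmaSet (v : Fin 3 → V2) : Set (V2 → Mat2) :=
  {τ | IsPolyMat 3 τ ∧ (∀ x, (τ x).IsSymm) ∧ IsPolyVec 1 (divMat τ) ∧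
    ∀ i : Fin 3, IsPoly1 2 fun s => dot2 (tang v i) ((τ (edgePt v i s)).mulVec (nrml v i))}

/-- The Airy operator: (airy q)₁₁ = ∂²q/∂x₂², (airy q)₁₂ = (airy q)₂₁ = -∂²q/∂x₁∂x₂,
(airy q)₂₂ = ∂²q/∂x₁². -/
def airy (q : V2 → ℝ) : V2 → Mat2 := fun x =>
  Matrix.of ![![pd (pd q 1) 1 x, -(pd (pd q 1) 0 x)],
              ![-(pd (pd q 1) 0 x), pd (pd q 0) 0 x]]

/-- The shape function space ℙ₅⁻(K) of the Bell element:
quintic polynomials whose normal derivative on each edge has degree at most 3. -/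
def P5m (v : Fin 3 → V2) : Set (V2 → ℝ) :=
  {q | PolyDeg 5 q ∧ ∀ i : Fin 3, IsPoly1 3 fun s => dirD q (nrml v i) (edgePt v i s)}

/-- The space RM of rigid motions in two dimensions: x ↦ a + b (x₂, −x₁)ᵀ. -/
def RM2 : Set (V2 → V2) := {u | ∃ a : V2, ∃ b : ℝ, ∀ x, u x = a + b • ![x 1, -(x 0)]}

/-- The reduced shape function space Σʳ(K) = {τ ∈ ℙ₃(K;𝕊) : div τ ∈ RM,
tᵀτn restricted to each edge has degree at most 2}. -/
def SigmaR (v : Fin 3 → V2) : Set (V2 → Mat2) :=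
  {τ | IsPolyMat 3 τ ∧ (∀ x, (τ x).IsSymm) ∧ divMat τ ∈ RM2 ∧
    ∀ i : Fin 3, IsPoly1 2 fun s => dot2 (tang v i) ((τ (edgePt v i s)).mulVec (nrml v i))}

open MvPolynomial in
theorem totalDegree_le_iff_degree_le {σ : Type*} {p : MvPolynomial σ ℝ} {k : ℕ} :
    p.totalDegree ≤ k ↔ ∀ m ∈ p.support, m.degree ≤ k :=
  Finset.sup_le_iff

open MvPolynomial in
theorem totalDegree_pderiv_le {σ : Type*} (i : σ) {p : MvPolynomial σ ℝ} {k : ℕ}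
    (hp : p.totalDegree ≤ k + 1) : (pderiv i p).totalDegree ≤ k := by
  classical
  rw [totalDegree_le_iff_degree_le] at hp ⊢
  intro m hm
  rw [mem_support_iff, coeff_pderiv] at hm
  have h := hp _ (mem_support_iff.2 (left_ne_zero_of_mul hm))
  rw [map_add, Finsupp.degree_single] at h
  omega

open MvPolynomial in
theorem exists_coeff_pderiv_ne_zero {σ : Type*} {p : MvPolynomial σ ℝ} {m : σ →₀ ℕ}
    (hm : coeff m p ≠ 0) (h0 : m ≠ 0) :
    ∃ i m', m = m' + Finsupp.single i 1 ∧ coeff m' (pderiv i p) ≠ 0 := by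
  classical
  obtain ⟨i, hi⟩ := Finsupp.ne_iff.1 h0
  have h : m = (m - Finsupp.single i 1) + Finsupp.single i 1 := by
    ext j
    by_cases hj : j = i
    · subst hj
      simp at hi ⊢
      omega
    · simp [Ne.symm hj]
  refine ⟨i, _, h, ?_⟩
  rw [coeff_pderiv, ← h]
  exact mul_ne_zero hm (by positivity)

open MvPolynomial in
theorem totalDegree_le_succ_of_pderiv {σ : Type*} {p : MvPolynomial σ ℝ} {k : ℕ}
    (hp : ∀ i, (pderiv i p).totalDegree ≤ k) : p.totalDegree ≤ k + 1 := by
  simp only [totalDegree_le_iff_degree_le] at hp ⊢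
  intro m hm
  by_cases h0 : m = 0
  · simp [h0]
  obtain ⟨i, m', rfl, h⟩ := exists_coeff_pderiv_ne_zero (mem_support_iff.1 hm) h0
  have := hp i m' (mem_support_iff.2 h)
  rw [map_add, Finsupp.degree_single]
  omega

open MvPolynomial in
theorem totalDegree_eq_zero_of_pderiv {σ : Type*} {p : MvPolynomial σ ℝ}
    (hp : ∀ i, pderiv i p = 0) : p.totalDegree ≤ 0 := by
  rw [totalDegree_le_iff_degree_le]
  intro m hm
  by_contra h0
  obtain ⟨i, m', rfl, h⟩ := exists_coeff_pderiv_ne_zero (mem_support_iff.1 hm)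
    (by rintro rfl; simp at h0)
  simp [hp] at h

open MvPolynomial in
theorem pderiv_eq_zero_of_totalDegree {σ : Type*} (i : σ) {p : MvPolynomial σ ℝ}
    (hp : p.totalDegree ≤ 0) : pderiv i p = 0 := by
  rw [totalDegree_eq_zero_iff_eq_C.1 (Nat.le_zero.1 hp), pderiv_C]

open MvPolynomial in
theorem pderiv_comm {σ : Type*} (i j : σ) (p : MvPolynomial σ ℝ) :
    pderiv i (pderiv j p) = pderiv j (pderiv i p) := by
  classical
  ext m
  simp only [coeff_pderiv, Finsupp.add_apply, Finsupp.single_apply]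
  rw [add_right_comm]
  by_cases h : i = j
  · subst h; ring
  · simp [h, Ne.symm h]; ring

open MvPolynomial in
theorem homogeneousComponent_pderiv {σ : Type*} (i : σ) (n : ℕ) (p : MvPolynomial σ ℝ) :
    homogeneousComponent n (pderiv i p) = pderiv i (homogeneousComponent (n + 1) p) := by
  ext m
  simp only [coeff_pderiv, coeff_homogeneousComponent, map_add, Finsupp.degree_single,
    add_left_inj, ite_mul, zero_mul]

open MvPolynomial in
/-- The Poincaré lemma for plane polynomial vector fields, with control of the degree. -/
theorem exists_potential {f g : MvPolynomial (Fin 2) ℝ} {N : ℕ} (hf : f.totalDegree ≤ N)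
    (hg : g.totalDegree ≤ N) (hfg : pderiv 1 f = pderiv 0 g) :
    ∃ p : MvPolynomial (Fin 2) ℝ, p.totalDegree ≤ N + 1 ∧ pderiv 0 p = f ∧ pderiv 1 p = g := by
  have hcurl : ∀ n, pderiv 1 (homogeneousComponent n f) = pderiv 0 (homogeneousComponent n g) := by
    rintro (_ | n)
    · simp
    · rw [← homogeneousComponent_pderiv, ← homogeneousComponent_pderiv, hfg]
  have hsum : ∀ {h : MvPolynomial (Fin 2) ℝ}, h.totalDegree ≤ N →
      ∑ n ∈ Finset.range (N + 1), homogeneousComponent n h = h := by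
    intro h hh
    conv_rhs => rw [← sum_homogeneousComponent h]
    symm
    apply Finset.sum_subset (by simpa using hh)
    intro n _ hn
    exact homogeneousComponent_eq_zero _ _ (by simpa using hn)
  have euler : ∀ n (h : MvPolynomial (Fin 2) ℝ),
      X 0 * pderiv 0 (homogeneousComponent n h) + X 1 * pderiv 1 (homogeneousComponent n h)
        = C (n : ℝ) * homogeneousComponent n h := by
    intro n h
    have := (homogeneousComponent_isHomogeneous n h).sum_X_mul_pderiv
    simpa using this
  have hC : ∀ n : ℕ, (C ((n : ℝ) + 1)⁻¹ * (C (n : ℝ) + 1) : MvPolynomial (Fin 2) ℝ) = 1 := by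
    intro n
    rw [← C_1, ← C_add, ← C_mul, inv_mul_cancel₀ (by positivity)]
  refine ⟨∑ n ∈ Finset.range (N + 1), C ((n : ℝ) + 1)⁻¹ *
    (X 0 * homogeneousComponent n f + X 1 * homogeneousComponent n g), ?_, ?_, ?_⟩
  · refine totalDegree_finsetSum_le fun n hn => ?_
    have hX : ∀ (i : Fin 2) (h : MvPolynomial (Fin 2) ℝ),
        (X i * homogeneousComponent n h).totalDegree ≤ N + 1 := by
      intro i h
      have h1 := (homogeneousComponent_isHomogeneous n h).totalDegree_le
      have h2 := totalDegree_mul (X i) (homogeneousComponent n h)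
      rw [totalDegree_X] at h2
      have := Finset.mem_range.1 hn
      omega
    rw [C_mul']
    exact (totalDegree_smul_le _ _).trans ((totalDegree_add _ _).trans (max_le (hX _ _) (hX _ _)))
  · conv_rhs => rw [← hsum hf]
    rw [map_sum]
    refine Finset.sum_congr rfl fun n _ => ?_
    simp only [C_mul', Derivation.map_smul, map_add, pderiv_mul, pderiv_X_self, pderiv_X_of_ne one_ne_zero,
      ← hcurl]
    simp only [← C_mul']
    linear_combination C ((n : ℝ) + 1)⁻¹ * euler n f + homogeneousComponent n f * hC n
  · conv_rhs => rw [← hsum hg]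
    rw [map_sum]
    refine Finset.sum_congr rfl fun n _ => ?_
    simp only [C_mul', Derivation.map_smul, map_add, pderiv_mul, pderiv_X_self, pderiv_X_of_ne zero_ne_one,
      hcurl]
    simp only [← C_mul']
    linear_combination C ((n : ℝ) + 1)⁻¹ * euler n g + homogeneousComponent n g * hC n

open MvPolynomial in
theorem finrank_restrictTotalDegree_fin_two (k : ℕ) :
    Module.finrank ℝ (restrictTotalDegree (Fin 2) ℝ k) =
      (((Finset.range (k + 1)) ×ˢ (Finset.range (k + 1))).filter fun a => a.1 + a.2 ≤ k).card := by
  have e : {n : Fin 2 →₀ ℕ | (n.sum fun _ e => e) ≤ k} ≃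
      (((Finset.range (k + 1)) ×ˢ (Finset.range (k + 1))).filter fun a => a.1 + a.2 ≤ k) :=
    (Finsupp.equivFunOnFinite.trans (finTwoArrowEquiv ℕ)).subtypeEquiv fun n => by
      simp [Finsupp.sum_fintype]
      omega
  rw [restrictTotalDegree, Module.finrank_eq_nat_card_basis
    (basisRestrictSupport ℝ {n : Fin 2 →₀ ℕ | (n.sum fun _ e => e) ≤ k}), Nat.card_congr e,
    Nat.card_eq_fintype_card, Fintype.card_coe]

open MvPolynomial in
theorem hasFDerivAt_eval {σ : Type*} [Fintype σ] (p : MvPolynomial σ ℝ) (x : σ → ℝ) :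
    HasFDerivAt (fun y : σ → ℝ => eval y p)
      (∑ a, eval x (pderiv a p) • ContinuousLinearMap.proj (R := ℝ) (φ := fun _ : σ => ℝ) a) x := by
  classical
  induction p using MvPolynomial.induction_on with
  | C c => simpa using hasFDerivAt_const c x
  | add p q hp hq =>
    simp only [map_add, add_smul, Finset.sum_add_distrib]
    exact hp.add hq
  | mul_X p i hp =>
    have := hp.mul (hasFDerivAt_apply (𝕜 := ℝ) i x)
    simp only [map_mul, eval_X]
    refine this.congr_fderiv ?_
    ext w
    simp [pderiv_X, Pi.single_apply, add_mul, Finset.sum_add_distrib, Finset.mul_sum, mul_assoc,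
      apply_ite (eval x), ite_mul]

/-- Real polynomials in two variables. -/
abbrev Poly2 := MvPolynomial (Fin 2) ℝ

/-- 2×2 matrices of real polynomials in two variables. -/
abbrev MatPoly2 := Matrix (Fin 2) (Fin 2) Poly2

open MvPolynomial in
/-- The directional derivative of polynomials in direction `w`. -/
def dirDer (w : V2) : Derivation ℝ Poly2 Poly2 := w 0 • pderiv 0 + w 1 • pderiv 1

open MvPolynomial in
theorem dirDer_apply (w : V2) (p : Poly2) :
    dirDer w p = w 0 • pderiv 0 p + w 1 • pderiv 1 p := rfl

/-- The direction vector of the edge `e i`. -/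
def edgeVec (v : Fin 3 → V2) (i : Fin 3) : V2 := v (i + 2) - v (i + 1)

/-- Restriction of polynomials to the edge `e i`, in its affine parametrization. -/
def edgePoly (v : Fin 3 → V2) (i : Fin 3) : Poly2 →ₐ[ℝ] Polynomial ℝ :=
  MvPolynomial.aeval fun a =>
    Polynomial.C (v (i + 1) a) + Polynomial.X * Polynomial.C (edgeVec v i a)

/-- The matrix field defined by a matrix of polynomials. -/
def matEval : MatPoly2 →ₗ[ℝ] (V2 → Mat2) where
  toFun M x := M.map (MvPolynomial.eval x)
  map_add' M N := by ext; simp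
  map_smul' c M := by ext; simp [MvPolynomial.smul_eval]

open MvPolynomial in
/-- The Airy operator on polynomials. -/
def airyPoly : Poly2 →ₗ[ℝ] MatPoly2 where
  toFun q := Matrix.of ![![pderiv 1 (pderiv 1 q), -pderiv 0 (pderiv 1 q)],
    ![-pderiv 0 (pderiv 1 q), pderiv 0 (pderiv 0 q)]]
  map_add' p q := by ext i j : 1; fin_cases i <;> fin_cases j <;> simp [add_comm]
  map_smul' c q := by ext i j : 1; fin_cases i <;> fin_cases j <;> simp

open MvPolynomial in
/-- The rigid motion `x ↦ a + b (x₂, −x₁)ᵀ` with `c = (a₁, a₂, b)`. -/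
def rmPoly : (Fin 3 → ℝ) →ₗ[ℝ] (Fin 2 → Poly2) where
  toFun c := ![C (c 0) + C (c 2) * X 1, C (c 1) - C (c 2) * X 0]
  map_add' c d := by ext i : 1; fin_cases i <;> simp <;> ring
  map_smul' r c := by ext i : 1; fin_cases i <;> simp [smul_eq_C_mul] <;> ring

open MvPolynomial in
/-- The field `x ↦ sym(u(x) xᵀ)` for a rigid motion `u`. -/
def symPoly : (Fin 3 → ℝ) →ₗ[ℝ] MatPoly2 where
  toFun c := Matrix.of fun i j => (2 : ℝ)⁻¹ • (rmPoly c i * X j + rmPoly c j * X i)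
  map_add' c d := by ext i j : 1; simp [smul_eq_C_mul]; ring
  map_smul' r c := by ext i j : 1; simp [smul_eq_C_mul]; ring

open MvPolynomial in
/-- Row-wise divergence of a matrix of polynomials. -/
def divPoly : MatPoly2 →ₗ[ℝ] (Fin 2 → Poly2) where
  toFun M i := ∑ j, pderiv j (M i j)
  map_add' M N := by ext i : 1; simp; ring
  map_smul' c M := by ext i : 1; simp

/-- The component `tᵀ M n`, where `n` is `t` rotated. -/
def shear (t : V2) : MatPoly2 →ₗ[ℝ] Poly2 where
  toFun M := ∑ i, ∑ j, (t i * rot t j) • M i j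
  map_add' M N := by simp; ring
  map_smul' c M := by simp [smul_smul, mul_comm]

/-- The top-order coefficients of the normal derivatives of a quintic along the edges. -/
def normalCoeff (v : Fin 3 → V2) : Poly2 →ₗ[ℝ] (Fin 3 → ℝ) :=
  LinearMap.pi fun i => Polynomial.lcoeff ℝ 4 ∘ₗ (edgePoly v i).toLinearMap ∘ₗ
    (dirDer (nrml v i)).toLinearMap

theorem normalCoeff_apply (v : Fin 3 → V2) (p : Poly2) (i : Fin 3) :
    normalCoeff v p i = (edgePoly v i (dirDer (nrml v i) p)).coeff 4 := rfl

/-- The polynomials defining the shape functions of the Bell element. -/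
def bellPoly (v : Fin 3 → V2) : Submodule ℝ Poly2 :=
  MvPolynomial.restrictTotalDegree (Fin 2) ℝ 5 ⊓ LinearMap.ker (normalCoeff v)

open MvPolynomial in
/-- The matrices of polynomials defining the fields in the reduced space Σʳ. -/
def sigmaPoly (v : Fin 3 → V2) : Submodule ℝ MatPoly2 where
  carrier := {M | (∀ i j, M i j ∈ restrictTotalDegree (Fin 2) ℝ 3) ∧ M 0 1 = M 1 0 ∧
    divPoly M ∈ LinearMap.range rmPoly ∧
    ∀ i, (edgePoly v i (shear (tang v i) M)).coeff 3 = 0}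
  add_mem' := by
    rintro M N ⟨h1, h2, h3, h4⟩ ⟨k1, k2, k3, k4⟩
    refine ⟨fun i j => add_mem (h1 i j) (k1 i j), by simp [h2, k2], ?_, fun i => ?_⟩
    · rw [map_add]; exact add_mem h3 k3
    · simp [h4, k4]
  zero_mem' := ⟨fun i j => zero_mem _, rfl, by simp, fun i => by simp⟩
  smul_mem' := by
    rintro c M ⟨h1, h2, h3, h4⟩
    refine ⟨fun i j => Submodule.smul_mem _ c (h1 i j), by simp [h2], ?_, fun i => ?_⟩
    · rw [map_smul]; exact Submodule.smul_mem _ c h3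
    · simp [h4]

theorem pd_eval (p : Poly2) (a : Fin 2) :
    pd (fun x => MvPolynomial.eval x p) a =
      fun x => MvPolynomial.eval x (MvPolynomial.pderiv a p) := by
  funext x
  fin_cases a <;> simp [pd, (hasFDerivAt_eval p x).fderiv]

theorem dirD_eval (p : Poly2) (w x : V2) :
    dirD (fun y => MvPolynomial.eval y p) w x = MvPolynomial.eval x (dirDer w p) := by
  simp [dirD, (hasFDerivAt_eval p x).fderiv, dirDer_apply, MvPolynomial.smul_eval, mul_comm]

theorem eval_edgePoly (v : Fin 3 → V2) (i : Fin 3) (p : Poly2) (s : ℝ) :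
    (edgePoly v i p).eval s = MvPolynomial.eval (edgePt v i s) p := by
  induction p using MvPolynomial.induction_on with
  | C c => simp [MvPolynomial.algHom_C]
  | add p q hp hq => simp [hp, hq]
  | mul_X p a hp =>
    rw [map_mul, Polynomial.eval_mul, hp]
    simp [edgePoly, edgePt, edgeVec]

theorem natDegree_edgePoly_le (v : Fin 3 → V2) (i : Fin 3) {p : Poly2} {k : ℕ}
    (hp : p.totalDegree ≤ k) : (edgePoly v i p).natDegree ≤ k := by
  have h := MvPolynomial.aeval_natDegree_le (n := 1) p hp
    (fun a => Polynomial.C (v (i + 1) a) + Polynomial.X * Polynomial.C (edgeVec v i a))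
    (fun a => by compute_degree)
  simpa [edgePoly] using h

theorem derivative_edgePoly (v : Fin 3 → V2) (i : Fin 3) (p : Poly2) :
    Polynomial.derivative (edgePoly v i p) = edgePoly v i (dirDer (edgeVec v i) p) := by
  induction p using MvPolynomial.induction_on with
  | C c => simp [MvPolynomial.algHom_C]
  | add p q hp hq => simp [hp, hq]
  | mul_X p a hp =>
    simp only [map_mul, Polynomial.derivative_mul, hp, Derivation.leibniz, smul_eq_mul, map_add]
    fin_cases a <;>
      simp [edgePoly, dirDer_apply, MvPolynomial.pderiv_X, Algebra.smul_def] <;> ring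

theorem isPoly1_eval_iff (k : ℕ) (r : Polynomial ℝ) :
    IsPoly1 k (fun s => r.eval s) ↔ r.natDegree ≤ k := by
  refine ⟨?_, fun h => ⟨r, h, fun _ _ => rfl⟩⟩
  rintro ⟨p, hp, h⟩
  rwa [Polynomial.eq_of_infinite_eval_eq r p
    ((Set.Icc_infinite (zero_lt_one' ℝ)).mono h)]

theorem natDegree_le_iff_coeff_eq_zero {r : Polynomial ℝ} {k : ℕ} (hr : r.natDegree ≤ k + 1) :
    r.natDegree ≤ k ↔ r.coeff (k + 1) = 0 := by
  refine ⟨fun h => Polynomial.coeff_eq_zero_of_natDegree_lt (by omega), fun h => ?_⟩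
  by_contra hk
  have e : r.natDegree = k + 1 := by omega
  rw [← e, Polynomial.coeff_natDegree, Polynomial.leadingCoeff_eq_zero] at h
  simp [h] at e

theorem matEval_injective : Function.Injective matEval := by
  intro M N h
  ext i j : 1
  refine MvPolynomial.funext fun x => ?_
  exact congrFun (congrFun (congrFun h x) i) j

theorem airy_eval (q : Poly2) : airy (fun x => MvPolynomial.eval x q) = matEval (airyPoly q) := by
  funext x
  ext i j
  fin_cases i <;> fin_cases j <;> simp [airy, matEval, airyPoly, pd_eval]

theorem divMat_matEval (M : MatPoly2) :
    divMat (matEval M) = fun x i => MvPolynomial.eval x (divPoly M i) := by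
  funext x i
  simp [divMat, matEval, divPoly, pd_eval]

theorem eval_shear (t : V2) (M : MatPoly2) (x : V2) :
    MvPolynomial.eval x (shear t M) = dot2 t ((matEval M x).mulVec (rot t)) := by
  simp [shear, dot2, matEval, Matrix.mulVec, dotProduct, MvPolynomial.smul_eval]
  ring

open MvPolynomial in
theorem mem_RM2_iff (u : V2 → V2) :
    u ∈ RM2 ↔ ∃ c, u = fun x i => eval x (rmPoly c i) := by
  constructor
  · rintro ⟨a, b, h⟩
    refine ⟨![a 0, a 1, b], ?_⟩
    funext x i
    fin_cases i <;> simp [h, rmPoly]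
    ring
  · rintro ⟨c, rfl⟩
    refine ⟨![c 0, c 1], c 2, fun x => ?_⟩
    ext i
    fin_cases i <;> simp [rmPoly]
    ring

theorem symm2_vecMulVec_eval (c : Fin 3 → ℝ) :
    (fun x => symm2 (Matrix.vecMulVec (fun i => MvPolynomial.eval x (rmPoly c i)) x)) =
      matEval (symPoly c) := by
  funext x
  ext i j
  simp [symm2, matEval, symPoly, Matrix.vecMulVec_apply, MvPolynomial.smul_eval]
  ring

theorem totalDegree_shear_le {t : V2} {M : MatPoly2} {k : ℕ}
    (hM : ∀ i j, (M i j).totalDegree ≤ k) : (shear t M).totalDegree ≤ k :=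
  MvPolynomial.totalDegree_finsetSum_le fun i _ =>
    MvPolynomial.totalDegree_finsetSum_le fun j _ =>
      (MvPolynomial.totalDegree_smul_le _ _).trans (hM i j)

theorem totalDegree_dirDer_le {w : V2} {p : Poly2} {k : ℕ} (hp : p.totalDegree ≤ k + 1) :
    (dirDer w p).totalDegree ≤ k :=
  (MvPolynomial.totalDegree_add _ _).trans <| max_le
    ((MvPolynomial.totalDegree_smul_le _ _).trans (totalDegree_pderiv_le 0 hp))
    ((MvPolynomial.totalDegree_smul_le _ _).trans (totalDegree_pderiv_le 1 hp))

theorem mem_P5m_iff (v : Fin 3 → V2) (q : V2 → ℝ) :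
    q ∈ P5m v ↔ ∃ p ∈ bellPoly v, q = fun x => MvPolynomial.eval x p := by
  have key : ∀ p : Poly2, p.totalDegree ≤ 5 → ∀ i,
      ((IsPoly1 3 fun s => dirD (fun x => MvPolynomial.eval x p) (nrml v i) (edgePt v i s)) ↔
        normalCoeff v p i = 0) := by
    intro p hp i
    simp only [dirD_eval, ← eval_edgePoly]
    rw [isPoly1_eval_iff, normalCoeff_apply]
    exact natDegree_le_iff_coeff_eq_zero
      (natDegree_edgePoly_le v i (totalDegree_dirDer_le (k := 4) hp))
  constructor
  · rintro ⟨⟨p, hp, h⟩, hq⟩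
    obtain rfl : q = _ := funext h
    refine ⟨p, ⟨(MvPolynomial.mem_restrictTotalDegree _ _ _).2 hp, ?_⟩, rfl⟩
    exact funext fun i => (key p hp i).1 (hq i)
  · rintro ⟨p, ⟨hp, hk⟩, rfl⟩
    have hp := (MvPolynomial.mem_restrictTotalDegree _ _ _).1 hp
    exact ⟨⟨p, hp, fun _ => rfl⟩, fun i => (key p hp i).2 (congrFun hk i)⟩

theorem mem_SigmaR_iff (v : Fin 3 → V2) (τ : V2 → Mat2) :
    τ ∈ SigmaR v ↔ ∃ M ∈ sigmaPoly v, τ = matEval M := by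
  have key : ∀ M : MatPoly2, (∀ i j, (M i j).totalDegree ≤ 3) → ∀ i,
      ((IsPoly1 2 fun s => dot2 (tang v i) ((matEval M (edgePt v i s)).mulVec (nrml v i))) ↔
        (edgePoly v i (shear (tang v i) M)).coeff 3 = 0) := by
    intro M hM i
    simp only [nrml, ← eval_shear, ← eval_edgePoly]
    rw [isPoly1_eval_iff]
    exact natDegree_le_iff_coeff_eq_zero
      (natDegree_edgePoly_le v i (totalDegree_shear_le (k := 3) hM))
  have keyDiv : ∀ M, divMat (matEval M) ∈ RM2 ↔ divPoly M ∈ LinearMap.range rmPoly := by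
    intro M
    rw [divMat_matEval, mem_RM2_iff]
    constructor
    · rintro ⟨c, h⟩
      refine ⟨c, funext fun i => MvPolynomial.funext fun x => ?_⟩
      exact (congrFun (congrFun h x) i).symm
    · rintro ⟨c, h⟩
      exact ⟨c, by rw [h]⟩
  constructor
  · rintro ⟨hP, hs, hd, he⟩
    choose M hM h using hP
    obtain rfl : τ = matEval (Matrix.of M) := by
      funext x
      ext i j
      exact h i j x
    refine ⟨Matrix.of M, ⟨fun i j => (MvPolynomial.mem_restrictTotalDegree _ _ _).2 (hM i j),
      MvPolynomial.funext fun x => ?_, (keyDiv _).1 hd, fun i => (key _ hM i).1 (he i)⟩, rfl⟩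
    exact (hs x).apply 1 0
  · rintro ⟨M, ⟨hM, hs, hd, he⟩, rfl⟩
    simp only [MvPolynomial.mem_restrictTotalDegree] at hM
    refine ⟨fun i j => ⟨M i j, hM i j, fun _ => rfl⟩, fun x => ?_, (keyDiv M).2 hd,
      fun i => (key M hM i).2 (he i)⟩
    refine Matrix.IsSymm.ext fun i j => ?_
    fin_cases i <;> fin_cases j <;> simp [matEval, hs]

theorem shear_airyPoly (t : V2) (q : Poly2) :
    shear t (airyPoly q) = -dirDer t (dirDer (rot t) q) := by
  simp only [shear, airyPoly, dirDer_apply, rot, LinearMap.coe_mk, AddHom.coe_mk, Fin.sum_univ_two,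
    map_add, Derivation.map_smul, Matrix.of_apply, Matrix.cons_val_zero, Matrix.cons_val_one,
    pderiv_comm 1 0 q]
  simp only [MvPolynomial.smul_eq_C_mul, MvPolynomial.C_mul, MvPolynomial.C_neg]
  ring

theorem coeff_edgePoly_shear_airyPoly (v : Fin 3 → V2) (i : Fin 3) (q : Poly2) :
    (edgePoly v i (shear (tang v i) (airyPoly q))).coeff 3 =
      -((elen v i)⁻¹ * 4) * normalCoeff v q i := by
  have h : ∀ p, dirDer (tang v i) p = (elen v i)⁻¹ • dirDer (edgeVec v i) p := fun p => by
    simp [dirDer_apply, tang, edgeVec, smul_smul]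
  rw [shear_airyPoly, h, map_neg, map_smul, ← derivative_edgePoly, normalCoeff_apply,
    Polynomial.coeff_neg, Polynomial.coeff_smul, Polynomial.coeff_derivative, nrml, smul_eq_mul]
  norm_num
  ring

theorem divPoly_airyPoly (q : Poly2) : divPoly (airyPoly q) = 0 := by
  ext i : 1
  fin_cases i
  · simp [divPoly, airyPoly, pderiv_comm 1 0 (MvPolynomial.pderiv 1 q)]
  · simp [divPoly, airyPoly, pderiv_comm 1 0 (MvPolynomial.pderiv 0 q), pderiv_comm 1 0 q]

open MvPolynomial in
theorem divPoly_symPoly (c : Fin 3 → ℝ) :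
    divPoly (symPoly c) = rmPoly ![3 / 2 * c 0, 3 / 2 * c 1, 2 * c 2] := by
  have h : ∀ r : ℝ, (C (2 : ℝ)⁻¹ * 2 * C r : Poly2) = C r := fun r => by
    rw [← map_ofNat C 2, ← C_mul, ← C_mul]; norm_num
  have h3 : (C (3 / 2 : ℝ) : Poly2) = 3 * C (2 : ℝ)⁻¹ := by
    rw [← map_ofNat C 3, ← C_mul]; norm_num
  have h2 : (C (2 : ℝ) : Poly2) = 2 := map_ofNat C 2
  ext i : 1
  fin_cases i
  · simp [divPoly, symPoly, rmPoly, pderiv_X, smul_eq_C_mul, h2, h3]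
    linear_combination (2 * X 1) * h (c 2)
  · simp [divPoly, symPoly, rmPoly, pderiv_X, smul_eq_C_mul, h2, h3]
    linear_combination -(2 * X 0) * h (c 2)

theorem rmPoly_injective : Function.Injective rmPoly := by
  refine (injective_iff_map_eq_zero _).2 fun c h => ?_
  have e : ∀ x i, MvPolynomial.eval x (rmPoly c i) = 0 := fun x i => by simp [h]
  have h0 := e 0 0
  have h1 := e 0 1
  have h2 := e ![0, 1] 0
  simp [rmPoly] at h0 h1 h2
  ext i
  fin_cases i <;> simp_all

theorem symPoly_eq_zero_of_div {c : Fin 3 → ℝ} (h : divPoly (symPoly c) = 0) : c = 0 := by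
  rw [divPoly_symPoly] at h
  have h' := rmPoly_injective (h.trans (map_zero rmPoly).symm)
  have h0 := congrFun h' 0
  have h1 := congrFun h' 1
  have h2 := congrFun h' 2
  simp at h0 h1 h2
  ext i
  fin_cases i <;> assumption

theorem airyPoly_mem_iff {v : Fin 3 → V2} (hv : ∀ i, elen v i ≠ 0) {q : Poly2}
    (hq : q.totalDegree ≤ 5) : airyPoly q ∈ sigmaPoly v ↔ q ∈ bellPoly v := by
  have h : ∀ i, (edgePoly v i (shear (tang v i) (airyPoly q))).coeff 3 = 0 ↔
      normalCoeff v q i = 0 := fun i => by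
    rw [coeff_edgePoly_shear_airyPoly, mul_eq_zero, or_iff_right (by simp [hv i])]
  constructor
  · rintro ⟨-, -, -, h4⟩
    exact ⟨(MvPolynomial.mem_restrictTotalDegree _ _ _).2 hq, funext fun i => (h i).1 (h4 i)⟩
  · rintro ⟨-, hk⟩
    refine ⟨fun i j => (MvPolynomial.mem_restrictTotalDegree _ _ _).2 ?_, by simp [airyPoly],
      by simp [divPoly_airyPoly], fun i => (h i).2 (congrFun hk i)⟩
    have hd : ∀ a b, (MvPolynomial.pderiv a (MvPolynomial.pderiv b q)).totalDegree ≤ 3 :=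
      fun a b => totalDegree_pderiv_le a (totalDegree_pderiv_le b hq)
    fin_cases i <;> fin_cases j <;> simp [airyPoly, hd]

theorem totalDegree_rmPoly_le (c : Fin 3 → ℝ) (i : Fin 2) : (rmPoly c i).totalDegree ≤ 1 := by
  have h : ∀ (a b : ℝ) (j : Fin 2), (MvPolynomial.C a + MvPolynomial.C b * MvPolynomial.X j :
      Poly2).totalDegree ≤ 1 := fun a b j =>
    (MvPolynomial.totalDegree_add _ _).trans <| max_le (by simp) <|
      (MvPolynomial.totalDegree_mul _ _).trans (by simp)
  fin_cases i
  · exact h _ _ _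
  · simpa [rmPoly, sub_eq_add_neg] using h (c 1) (-c 2) 0

theorem totalDegree_symPoly_le (c : Fin 3 → ℝ) (i j : Fin 2) :
    (symPoly c i j).totalDegree ≤ 2 := by
  have h : ∀ i j : Fin 2, (rmPoly c i * MvPolynomial.X j).totalDegree ≤ 2 := fun i j =>
    (MvPolynomial.totalDegree_mul _ _).trans <| by
      have := totalDegree_rmPoly_le c i
      rw [MvPolynomial.totalDegree_X]
      omega
  exact (MvPolynomial.totalDegree_smul_le _ _).trans
    ((MvPolynomial.totalDegree_add _ _).trans (max_le (h i j) (h j i)))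

theorem symPoly_mem (v : Fin 3 → V2) (c : Fin 3 → ℝ) : symPoly c ∈ sigmaPoly v := by
  refine ⟨fun i j => (MvPolynomial.mem_restrictTotalDegree _ _ _).2
    ((totalDegree_symPoly_le c i j).trans (by norm_num)), ?_, ?_, fun i => ?_⟩
  · simp [symPoly, add_comm]
  · rw [divPoly_symPoly]
    exact LinearMap.mem_range_self _ _
  · refine Polynomial.coeff_eq_zero_of_natDegree_lt (Nat.lt_succ_iff.2 ?_)
    exact natDegree_edgePoly_le v i (totalDegree_shear_le (totalDegree_symPoly_le c))

open MvPolynomial in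
theorem exists_airyPoly_eq {M : MatPoly2} {N : ℕ} (hM : ∀ i j, (M i j).totalDegree ≤ N)
    (hs : M 0 1 = M 1 0) (hd : divPoly M = 0) :
    ∃ q : Poly2, q.totalDegree ≤ N + 2 ∧ airyPoly q = M := by
  have h0 := congrFun hd 0
  have h1 := congrFun hd 1
  simp [divPoly] at h0 h1
  obtain ⟨f, hf, hf0, hf1⟩ := exists_potential (f := -M 0 1) (g := M 0 0) (N := N)
    (by simpa using hM 0 1) (hM 0 0) (by rw [map_neg]; linear_combination -h0)
  obtain ⟨g, hg, hg0, hg1⟩ := exists_potential (f := M 1 1) (g := -M 0 1) (N := N)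
    (hM 1 1) (by simpa using hM 0 1) (by rw [map_neg, hs]; linear_combination h1)
  obtain ⟨q, hq, hq0, hq1⟩ := exists_potential hg hf (by rw [hg1, hf0])
  refine ⟨q, hq, ?_⟩
  ext i j : 1
  fin_cases i <;> fin_cases j <;> simp [airyPoly, hq0, hq1, hf0, hf1, hg0, hs]

theorem exists_decomposition {v : Fin 3 → V2} (hv : ∀ i, elen v i ≠ 0) {M : MatPoly2}
    (hM : M ∈ sigmaPoly v) : ∃ q ∈ bellPoly v, ∃ c, M = airyPoly q + symPoly c := by
  obtain ⟨c, hc⟩ := hM.2.2.1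
  set c' : Fin 3 → ℝ := ![2 / 3 * c 0, 2 / 3 * c 1, c 2 / 2] with hc'
  have hN : M - symPoly c' ∈ sigmaPoly v := sub_mem hM (symPoly_mem v c')
  have hdiv : divPoly (M - symPoly c') = 0 := by
    rw [map_sub, ← hc, divPoly_symPoly, sub_eq_zero]
    congr 1
    ext i
    fin_cases i <;> simp [hc'] <;> ring
  obtain ⟨q, hq, hqM⟩ := exists_airyPoly_eq
    (fun i j => (MvPolynomial.mem_restrictTotalDegree _ _ _).1 (hN.1 i j)) hN.2.1 hdiv
  refine ⟨q, (airyPoly_mem_iff hv hq).1 (hqM ▸ hN), c', ?_⟩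
  rw [hqM, sub_add_cancel]

theorem airyPoly_eq_zero_iff (q : Poly2) : airyPoly q = 0 ↔ q.totalDegree ≤ 1 := by
  constructor
  · intro h
    have h00 : MvPolynomial.pderiv 1 (MvPolynomial.pderiv 1 q) = 0 := congrFun (congrFun h 0) 0
    have h01 : -MvPolynomial.pderiv 0 (MvPolynomial.pderiv 1 q) = 0 := congrFun (congrFun h 0) 1
    have h11 : MvPolynomial.pderiv 0 (MvPolynomial.pderiv 0 q) = 0 := congrFun (congrFun h 1) 1
    rw [neg_eq_zero] at h01
    refine totalDegree_le_succ_of_pderiv fun i => totalDegree_eq_zero_of_pderiv fun j => ?_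
    fin_cases i <;> fin_cases j
    · exact h11
    · exact (pderiv_comm 1 0 q).trans h01
    · exact h01
    · exact h00
  · intro h
    have hd : ∀ a b, MvPolynomial.pderiv a (MvPolynomial.pderiv b q) = 0 := fun a b =>
      pderiv_eq_zero_of_totalDegree a (totalDegree_pderiv_le b h)
    ext i j : 1
    fin_cases i <;> fin_cases j <;> simp [airyPoly, hd]

theorem dot2_rot_edgeVec_ne_zero {v : Fin 3 → V2} (hv : AffineIndependent ℝ v) {i j : Fin 3}
    (hij : i ≠ j) : dot2 (rot (edgeVec v i)) (edgeVec v j) ≠ 0 := by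
  have hw : ∀ a b : ℝ, a • (v 1 - v 0) + b • (v 2 - v 0) = 0 → a = 0 ∧ b = 0 := by
    intro a b h
    have := affineIndependent_iff.1 hv Finset.univ ![-a - b, a, b]
      (by simp [Fin.sum_univ_three]; ring) (by
        rw [← h]
        simp only [Fin.sum_univ_three, Matrix.cons_val]
        module)
    exact ⟨this 1 (Finset.mem_univ _), this 2 (Finset.mem_univ _)⟩
  have hD : (v 1 0 - v 0 0) * (v 2 1 - v 0 1) - (v 1 1 - v 0 1) * (v 2 0 - v 0 0) ≠ 0 := by
    intro hD
    obtain ⟨h1, -⟩ := hw (v 2 1 - v 0 1) (-(v 1 1 - v 0 1)) (by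
      ext k
      fin_cases k <;> simp
      · linear_combination hD
      · ring)
    obtain ⟨h0, -⟩ := hw (v 2 0 - v 0 0) (-(v 1 0 - v 0 0)) (by
      ext k
      fin_cases k <;> simp
      · ring
      · linear_combination -hD)
    refine one_ne_zero (hw 0 1 ?_).2
    ext k
    fin_cases k <;> simpa
  intro h
  apply hD
  fin_cases i <;> fin_cases j <;> simp [dot2, rot, edgeVec] at hij h <;> first
    | linear_combination h
    | linear_combination -h

theorem elen_ne_zero {v : Fin 3 → V2} (hv : AffineIndependent ℝ v) (i : Fin 3) :
    elen v i ≠ 0 := by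
  have h := dot2_rot_edgeVec_ne_zero hv (show i + 1 ≠ i by fin_cases i <;> decide)
  intro h0
  apply h
  have h0 : edgeVec v i 0 * edgeVec v i 0 + edgeVec v i 1 * edgeVec v i 1 = 0 :=
    (Real.sqrt_eq_zero (add_nonneg (mul_self_nonneg _) (mul_self_nonneg _))).1 h0
  have h1 := mul_self_add_mul_self_eq_zero.1 h0
  simp [dot2, h1]

open MvPolynomial in
/-- An affine function vanishing on the edge `e i`. -/
def edgeForm (v : Fin 3 → V2) (i : Fin 3) : Poly2 :=
  C (rot (edgeVec v i) 0) * (X 0 - C (v (i + 1) 0)) +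
    C (rot (edgeVec v i) 1) * (X 1 - C (v (i + 1) 1))

theorem edgePoly_edgeForm (v : Fin 3 → V2) (i j : Fin 3) :
    edgePoly v j (edgeForm v i) =
      Polynomial.C (dot2 (rot (edgeVec v i)) (v (j + 1) - v (i + 1))) +
        Polynomial.X * Polynomial.C (dot2 (rot (edgeVec v i)) (edgeVec v j)) := by
  simp [edgeForm, edgePoly, MvPolynomial.algHom_C, dot2]
  ring

theorem edgePoly_edgeForm_self (v : Fin 3 → V2) (i : Fin 3) : edgePoly v i (edgeForm v i) = 0 := by
  have h : dot2 (rot (edgeVec v i)) (edgeVec v i) = 0 := by simp [dot2, rot]; ring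
  have h' : dot2 (rot (edgeVec v i)) (v (i + 1) - v (i + 1)) = 0 := by simp [dot2]
  rw [edgePoly_edgeForm, h, h']
  simp

theorem dirDer_edgeForm (v : Fin 3 → V2) (i : Fin 3) (w : V2) :
    dirDer w (edgeForm v i) = MvPolynomial.C (dot2 (rot (edgeVec v i)) w) := by
  simp [dirDer_apply, edgeForm, MvPolynomial.pderiv_X, MvPolynomial.smul_eq_C_mul, dot2]
  ring

theorem totalDegree_edgeForm_le (v : Fin 3 → V2) (i : Fin 3) :
    (edgeForm v i).totalDegree ≤ 1 := by
  have h : ∀ (a b : ℝ) (j : Fin 2), (MvPolynomial.C a * (MvPolynomial.X j - MvPolynomial.C b) :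
      Poly2).totalDegree ≤ 1 := fun a b j => by
    refine (MvPolynomial.totalDegree_mul _ _).trans ?_
    have := MvPolynomial.totalDegree_sub (MvPolynomial.X j : Poly2) (MvPolynomial.C b)
    simpa using this
  exact (MvPolynomial.totalDegree_add _ _).trans (max_le (h _ _ _) (h _ _ _))

/-- A quintic vanishing on all edges, whose normal derivative vanishes on all edges but `e i`. -/
def edgeBubble (v : Fin 3 → V2) (i : Fin 3) : Poly2 :=
  edgeForm v i * (edgeForm v (i + 1) * edgeForm v (i + 2)) ^ 2

theorem edgeBubble_mem (v : Fin 3 → V2) (i : Fin 3) :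
    edgeBubble v i ∈ MvPolynomial.restrictTotalDegree (Fin 2) ℝ 5 := by
  rw [MvPolynomial.mem_restrictTotalDegree]
  have h := totalDegree_edgeForm_le v
  have h1 := MvPolynomial.totalDegree_mul (edgeForm v i)
    ((edgeForm v (i + 1) * edgeForm v (i + 2)) ^ 2)
  have h2 := MvPolynomial.totalDegree_pow (edgeForm v (i + 1) * edgeForm v (i + 2)) 2
  have h3 := MvPolynomial.totalDegree_mul (edgeForm v (i + 1)) (edgeForm v (i + 2))
  have := h i
  have := h (i + 1)
  have := h (i + 2)
  unfold edgeBubble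
  omega

theorem edgePoly_dirDer_sq_mul (v : Fin 3 → V2) (j : Fin 3) (w : V2) (p : Poly2) :
    edgePoly v j (dirDer w (edgeForm v j ^ 2 * p)) = 0 := by
  simp [Derivation.leibniz, Derivation.leibniz_pow, edgePoly_edgeForm_self]

theorem normalCoeff_edgeBubble_of_ne (v : Fin 3 → V2) {i j : Fin 3} (hij : j ≠ i) :
    normalCoeff v (edgeBubble v i) j = 0 := by
  obtain ⟨p, hp⟩ : ∃ p, edgeBubble v i = edgeForm v j ^ 2 * p := by
    have : j = i + 1 ∨ j = i + 2 := by revert i j; decide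
    rcases this with rfl | rfl
    · exact ⟨edgeForm v i * edgeForm v (i + 2) ^ 2, by rw [edgeBubble]; ring⟩
    · exact ⟨edgeForm v i * edgeForm v (i + 1) ^ 2, by rw [edgeBubble]; ring⟩
  rw [normalCoeff_apply, hp, edgePoly_dirDer_sq_mul, Polynomial.coeff_zero]

theorem normalCoeff_edgeBubble_self_ne_zero {v : Fin 3 → V2} (hv : AffineIndependent ℝ v)
    (i : Fin 3) : normalCoeff v (edgeBubble v i) i ≠ 0 := by
  have h1 := dot2_rot_edgeVec_ne_zero hv (show i + 1 ≠ i by fin_cases i <;> decide)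
  have h2 := dot2_rot_edgeVec_ne_zero hv (show i + 2 ≠ i by fin_cases i <;> decide)
  have hn : dot2 (rot (edgeVec v i)) (nrml v i) ≠ 0 := by
    have hl := elen_ne_zero hv i
    have : dot2 (rot (edgeVec v i)) (nrml v i) = elen v i := by
      have hsq : elen v i * elen v i =
          edgeVec v i 0 * edgeVec v i 0 + edgeVec v i 1 * edgeVec v i 1 :=
        Real.mul_self_sqrt (add_nonneg (mul_self_nonneg _) (mul_self_nonneg _))
      have : dot2 (rot (edgeVec v i)) (nrml v i) = (elen v i)⁻¹ *
          (edgeVec v i 0 * edgeVec v i 0 + edgeVec v i 1 * edgeVec v i 1) := by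
        simp [dot2, rot, nrml, tang, edgeVec]
        ring
      rw [this, ← hsq, inv_mul_cancel_left₀ hl]
    rwa [this]
  have hc : ∀ a b c d : ℝ, (((Polynomial.C a + Polynomial.X * Polynomial.C b) *
      (Polynomial.C c + Polynomial.X * Polynomial.C d)) ^ 2).coeff 4 = (b * d) ^ 2 := by
    intro a b c d
    have hl : ∀ a b : ℝ, (Polynomial.C a + Polynomial.X * Polynomial.C b).natDegree ≤ 1 :=
      fun a b => by compute_degree
    rw [Polynomial.coeff_pow_of_natDegree_le (n := 2) (m := 2)
      (Polynomial.natDegree_mul_le_of_le (hl a b) (hl c d)),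
      Polynomial.coeff_mul_add_eq_of_natDegree_le (hl a b) (hl c d)]
    simp [Polynomial.coeff_C]
  rw [normalCoeff_apply, edgeBubble, Derivation.leibniz, map_add, smul_eq_mul, smul_eq_mul,
    map_mul, edgePoly_edgeForm_self, zero_mul, zero_add, dirDer_edgeForm, map_mul, map_pow,
    map_mul, MvPolynomial.algHom_C, Polynomial.algebraMap_eq, Polynomial.coeff_mul_C,
    edgePoly_edgeForm, edgePoly_edgeForm, hc]
  positivity

theorem finrank_bellPoly {v : Fin 3 → V2} (hv : AffineIndependent ℝ v) :
    Module.finrank ℝ (bellPoly v) = 18 := by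
  set F := (normalCoeff v).domRestrict (MvPolynomial.restrictTotalDegree (Fin 2) ℝ 5) with hF
  have hsurj : LinearMap.range F = ⊤ := by
    refine LinearMap.range_eq_top.2 fun y => ?_
    refine ⟨∑ i, (y i / normalCoeff v (edgeBubble v i) i) •
      ⟨edgeBubble v i, edgeBubble_mem v i⟩, funext fun j => ?_⟩
    simp only [map_sum, map_smul, hF, LinearMap.domRestrict_apply, Finset.sum_apply, Pi.smul_apply,
      smul_eq_mul]
    rw [Finset.sum_eq_single j (fun i _ hi => by
      rw [normalCoeff_edgeBubble_of_ne v hi.symm, mul_zero]) (by simp)]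
    exact div_mul_cancel₀ _ (normalCoeff_edgeBubble_self_ne_zero hv j)
  have hdim := LinearMap.finrank_range_add_finrank_ker F
  have hker : Module.finrank ℝ (LinearMap.ker F) = Module.finrank ℝ (bellPoly v) := by
    have : bellPoly v = (LinearMap.ker F).map (Submodule.subtype _) := by
      rw [hF, LinearMap.ker_domRestrict, Submodule.map_comap_subtype, bellPoly]
    rw [this, Submodule.finrank_map_subtype_eq]
  rw [hsurj, finrank_top, Module.finrank_fin_fun, hker, finrank_restrictTotalDegree_fin_two] at hdim
  have : (((Finset.range (5 + 1)) ×ˢ (Finset.range (5 + 1))).filter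
    fun a => a.1 + a.2 ≤ 5).card = 21 := by decide
  omega

theorem finrank_sigmaPoly {v : Fin 3 → V2} (hv : AffineIndependent ℝ v) :
    Module.finrank ℝ (sigmaPoly v) = 18 := by
  set G : (bellPoly v × (Fin 3 → ℝ)) →ₗ[ℝ] MatPoly2 :=
    (airyPoly.comp (bellPoly v).subtype).coprod symPoly with hG
  have hrange : LinearMap.range G = sigmaPoly v := by
    ext M
    constructor
    · rintro ⟨⟨q, c⟩, rfl⟩
      refine add_mem ?_ (symPoly_mem v c)
      exact (airyPoly_mem_iff (elen_ne_zero hv)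
        ((MvPolynomial.mem_restrictTotalDegree _ _ _).1 q.2.1)).2 q.2
    · intro hM
      obtain ⟨q, hq, c, rfl⟩ := exists_decomposition (elen_ne_zero hv) hM
      exact ⟨(⟨q, hq⟩, c), rfl⟩
  have hle : MvPolynomial.restrictTotalDegree (Fin 2) ℝ 1 ≤ bellPoly v := by
    intro q hq
    rw [MvPolynomial.mem_restrictTotalDegree] at hq
    rw [← airyPoly_mem_iff (elen_ne_zero hv) (hq.trans (by norm_num)),
      (airyPoly_eq_zero_iff q).2 hq]
    exact zero_mem _
  have hker : LinearMap.ker G =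
      LinearMap.range ((LinearMap.inl ℝ _ (Fin 3 → ℝ)).comp (Submodule.inclusion hle)) := by
    ext ⟨q, c⟩
    rw [LinearMap.mem_ker]
    constructor
    · intro h
      replace h : airyPoly q + symPoly c = 0 := h
      have hc : c = 0 := symPoly_eq_zero_of_div (by
        simpa [divPoly_airyPoly] using congrArg divPoly h)
      subst hc
      rw [map_zero, add_zero, airyPoly_eq_zero_iff, ← MvPolynomial.mem_restrictTotalDegree] at h
      exact ⟨⟨q, h⟩, rfl⟩
    · rintro ⟨p, hp⟩
      obtain ⟨rfl, rfl⟩ := Prod.mk.inj hp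
      have := (airyPoly_eq_zero_iff p).2 ((MvPolynomial.mem_restrictTotalDegree _ _ _).1 p.2)
      simp [hG, this]
  have : Module.Finite ℝ (bellPoly v) := Module.finite_of_finrank_pos (by simp [finrank_bellPoly hv])
  have hdim := LinearMap.finrank_range_add_finrank_ker G
  have hinj : Function.Injective
      ((LinearMap.inl ℝ (bellPoly v) (Fin 3 → ℝ)).comp (Submodule.inclusion hle)) :=
    LinearMap.inl_injective.comp (Submodule.inclusion_injective hle)
  rw [hrange, hker, LinearMap.finrank_range_of_inj hinj,
    Module.finrank_prod, finrank_bellPoly hv, Module.finrank_fin_fun,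
    finrank_restrictTotalDegree_fin_two] at hdim
  have : (((Finset.range (1 + 1)) ×ˢ (Finset.range (1 + 1))).filter
    fun a => a.1 + a.2 ≤ 1).card = 3 := by decide
  omega

/-- Σʳ(K) = airy(ℙ₅⁻(K)) ⊕ sym(RM·xᵀ) as an internal direct sum,
and dim Σʳ(K) = 18. -/
theorem statement8 (v : Fin 3 → V2) (hv : AffineIndependent ℝ v) :
    -- both summands are contained in Σʳ(K)
    (∀ q ∈ P5m v, airy q ∈ SigmaR v) ∧
    (∀ u ∈ RM2, (fun x => symm2 (Matrix.vecMulVec (u x) x)) ∈ SigmaR v) ∧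
    -- every τ ∈ Σʳ(K) decomposes as τ = airy q + sym(v(x)xᵀ) with v ∈ RM
    (∀ τ ∈ SigmaR v, ∃ q ∈ P5m v, ∃ u ∈ RM2,
      τ = fun x => airy q x + symm2 (Matrix.vecMulVec (u x) x)) ∧
    -- the two summand subspaces intersect trivially
    (∀ τ : V2 → Mat2, (∃ q ∈ P5m v, τ = airy q) →
      (∃ u ∈ RM2, τ = fun x => symm2 (Matrix.vecMulVec (u x) x)) → τ = 0) ∧
    -- dim Σʳ(K) = 18
    (∃ b : Fin 18 → (V2 → Mat2), (∀ m, b m ∈ SigmaR v) ∧ LinearIndependent ℝ b ∧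
      ∀ τ ∈ SigmaR v, ∃ c : Fin 18 → ℝ, τ = ∑ m, c m • b m) := by
  have hl := elen_ne_zero hv
  refine ⟨?_, ?_, ?_, ?_, ?_⟩
  · intro q hq
    obtain ⟨p, hp, rfl⟩ := (mem_P5m_iff v q).1 hq
    rw [airy_eval]
    exact (mem_SigmaR_iff v _).2 ⟨_, (airyPoly_mem_iff hl
      ((MvPolynomial.mem_restrictTotalDegree _ _ _).1 hp.1)).2 hp, rfl⟩
  · intro u hu
    obtain ⟨c, rfl⟩ := (mem_RM2_iff u).1 hu
    rw [symm2_vecMulVec_eval]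
    exact (mem_SigmaR_iff v _).2 ⟨_, symPoly_mem v c, rfl⟩
  · intro τ hτ
    obtain ⟨M, hM, rfl⟩ := (mem_SigmaR_iff v τ).1 hτ
    obtain ⟨p, hp, c, rfl⟩ := exists_decomposition hl hM
    refine ⟨_, (mem_P5m_iff v _).2 ⟨p, hp, rfl⟩, _, (mem_RM2_iff _).2 ⟨c, rfl⟩, ?_⟩
    rw [map_add, airy_eval, ← symm2_vecMulVec_eval]
    rfl
  · rintro τ ⟨q, hq, rfl⟩ ⟨u, hu, h⟩
    obtain ⟨p, hp, rfl⟩ := (mem_P5m_iff v q).1 hq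
    obtain ⟨c, rfl⟩ := (mem_RM2_iff u).1 hu
    rw [symm2_vecMulVec_eval, airy_eval] at h
    have h := matEval_injective h
    have hc : c = 0 := symPoly_eq_zero_of_div (by rw [← h, divPoly_airyPoly])
    rw [airy_eval, h, hc, map_zero, map_zero]
  · have hfin : Module.Finite ℝ (sigmaPoly v) :=
      Module.finite_of_finrank_pos (by simp [finrank_sigmaPoly hv])
    let B := Module.finBasisOfFinrankEq ℝ (sigmaPoly v) (finrank_sigmaPoly hv)
    refine ⟨fun m => matEval (B m), fun m => (mem_SigmaR_iff v _).2 ⟨_, (B m).2, rfl⟩, ?_, ?_⟩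
    · exact B.linearIndependent.map' (matEval.comp (sigmaPoly v).subtype)
        (LinearMap.ker_eq_bot.2 (matEval_injective.comp Subtype.val_injective))
    · intro τ hτ
      obtain ⟨M, hM, rfl⟩ := (mem_SigmaR_iff v τ).1 hτ
      refine ⟨B.repr ⟨M, hM⟩, ?_⟩
      have := congrArg (matEval.comp (sigmaPoly v).subtype) (B.sum_repr ⟨M, hM⟩)
      rw [map_sum] at this
      simpa using this.symm
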